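/- Let U ⊆ ℝ² be a contractible open set and let c, d : U → ℝ be smooth functions satisfying Xd + Yc = 0 on U. Then there exist smooth functions a, b : U → ℝ such that c = X²b − (XY + Z)a and d = Y²a − (YX − Z)b on U (i.e. the first Grushin complex is locally exact in degree two). -/

import Mathlib

/-- First Grushin operator `X = ∂/∂x` on `ℝ²` with coordinates `(x, y)`. -/
noncomputable def opX (f : (Fin 2 → ℝ) → ℝ) : (Fin 2 → ℝ) → ℝ :=
  fun p => fderiv ℝ f p ![1, 0]

/-- First Grushin operator `Y = x ∂/∂y` on `ℝ²`. -/
noncomputable def opY (f : (Fin 2 → ℝ) → ℝ) : (Fin 2 → ℝ) → ℝ :=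
  fun p => fderiv ℝ f p ![0, p 0]

/-- First Grushin operator `Z = [X, Y] = ∂/∂y` on `ℝ²`. -/
noncomputable def opZ (f : (Fin 2 → ℝ) → ℝ) : (Fin 2 → ℝ) → ℝ :=
  fun p => fderiv ℝ f p ![0, 1]

open Set Filter Topology MeasureTheory
open scoped ContDiff Manifold

theorem hasFDerivAt_integral_of_contDiffOn {E G : Type*} [NormedAddCommGroup E] [NormedSpace ℝ E]
    [FiniteDimensional ℝ E] [NormedAddCommGroup G] [NormedSpace ℝ G] [CompleteSpace G]
    {U : Set E} (hU : IsOpen U) {F : E × ℝ → G} {n : ℕ∞ω} (hn : 1 ≤ n)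
    (hF : ContDiffOn ℝ n F (U ×ˢ univ)) {p : E} (hp : p ∈ U) :
    HasFDerivAt (fun q => ∫ t in (0 : ℝ)..1, F (q, t))
      (∫ t in (0 : ℝ)..1, (fderiv ℝ F (p, t)).comp (ContinuousLinearMap.inl ℝ E ℝ)) p := by
  have hW : IsOpen (U ×ˢ (univ : Set ℝ)) := hU.prod isOpen_univ
  have hmem : ∀ {q : E} (t : ℝ), q ∈ U → (q, t) ∈ U ×ˢ (univ : Set ℝ) := fun t hq => ⟨hq, trivial⟩
  have hslice : ∀ {q : E}, q ∈ U → Continuous fun t : ℝ => F (q, t) := fun {q} hq =>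
    hF.continuousOn.comp_continuous (by fun_prop) fun t => hmem t hq
  have hder : ContinuousOn
      (fun z => (fderiv ℝ F z).comp (ContinuousLinearMap.inl ℝ E ℝ)) (U ×ˢ univ) :=
    (hF.continuousOn_fderiv_of_isOpen hW hn).clm_comp continuousOn_const
  obtain ⟨ε, hε, hεU⟩ := Metric.nhds_basis_closedBall.mem_iff.1 (hU.mem_nhds hp)
  have : ProperSpace E := FiniteDimensional.proper_real E
  obtain ⟨C, hC⟩ := ((isCompact_closedBall p ε).prod (isCompact_Icc (a := (0 : ℝ)) (b := 1))
    ).exists_bound_of_continuousOn (hder.mono (prod_mono hεU (subset_univ _)))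
  refine intervalIntegral.hasFDerivAt_integral_of_dominated_of_fderiv_le
    (F' := fun q t => (fderiv ℝ F (q, t)).comp (ContinuousLinearMap.inl ℝ E ℝ))
    (bound := fun _ => C) (Metric.closedBall_mem_nhds p hε) ?_ ?_ ?_ ?_ ?_ ?_
  · filter_upwards [hU.mem_nhds hp] with q hq
    exact (hslice hq).aestronglyMeasurable
  · exact (hslice hp).intervalIntegrable _ _
  · exact (hder.comp_continuous (by fun_prop : Continuous fun t : ℝ => (p, t))
      fun t => hmem t hp).aestronglyMeasurable
  · refine Eventually.of_forall fun t ht q hq => hC (q, t) ⟨hq, ?_⟩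
    rw [uIoc_of_le zero_le_one] at ht
    exact Ioc_subset_Icc_self ht
  · exact intervalIntegrable_const
  · refine Eventually.of_forall fun t _ q hq => ?_
    have h := ((hF.contDiffAt (hW.mem_nhds (hmem t (hεU hq)))).differentiableAt
      (zero_lt_one.trans_le hn).ne').hasFDerivAt
    exact h.comp q (hasFDerivAt_prodMk_left q t)

theorem contDiffOn_integral.{u} {E G : Type u} [NormedAddCommGroup E] [NormedSpace ℝ E]
    [FiniteDimensional ℝ E] [NormedAddCommGroup G] [NormedSpace ℝ G] [CompleteSpace G]
    {U : Set E} (hU : IsOpen U) {F : E × ℝ → G} (hF : ContDiffOn ℝ ∞ F (U ×ˢ univ)) :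
    ContDiffOn ℝ ∞ (fun q => ∫ t in (0 : ℝ)..1, F (q, t)) U := by
  have hW : IsOpen (U ×ˢ (univ : Set ℝ)) := hU.prod isOpen_univ
  rw [contDiffOn_infty]
  intro n
  induction n generalizing G with
  | zero =>
    exact contDiffOn_zero.2 fun p hp =>
      (hasFDerivAt_integral_of_contDiffOn hU (by simp) hF hp).continuousAt.continuousWithinAt
  | succ n ih =>
    push_cast
    rw [contDiffOn_succ_iff_fderiv_of_isOpen hU]
    refine ⟨fun p hp => (hasFDerivAt_integral_of_contDiffOn hU (by simp) hF hp
      ).differentiableAt.differentiableWithinAt, by simp, ?_⟩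
    refine (ih (F := fun z => (fderiv ℝ F z).comp (ContinuousLinearMap.inl ℝ E ℝ)) ?_).congr
      fun p hp => (hasFDerivAt_integral_of_contDiffOn hU (by simp) hF hp).fderiv
    exact (hF.fderiv_of_isOpen hW (by simp)).clm_comp contDiffOn_const

theorem exists_continuous_pos_ball_subset {E : Type*} [PseudoMetricSpace E] {U : Set E}
    (hU : IsOpen U) :
    ∃ δ : E → ℝ, Continuous δ ∧ ∀ p ∈ U, 0 < δ p ∧ Metric.ball p (δ p) ⊆ U := by
  rcases Uᶜ.eq_empty_or_nonempty with h | h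
  · exact ⟨fun _ => 1, continuous_const, fun p _ => ⟨one_pos, by simp [compl_empty_iff.1 h]⟩⟩
  · refine ⟨fun p => Metric.infDist p Uᶜ, Metric.continuous_infDist_pt _, fun p hp => ⟨?_, ?_⟩⟩
    · exact (hU.isClosed_compl.notMem_iff_infDist_pos h).1 (by simpa using hp)
    · exact Metric.ball_infDist_compl_subset

theorem exists_contDiffOn_contraction {E : Type*} [NormedAddCommGroup E] [NormedSpace ℝ E]
    [FiniteDimensional ℝ E] {U : Set E} (hU : IsOpen U) (hUc : ContractibleSpace U) :
    ∃ (h : E × ℝ → E) (x₀ : E), ContDiffOn ℝ ∞ h (U ×ˢ univ) ∧ (∀ p ∈ U, ∀ t, h (p, t) ∈ U) ∧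
      (∀ p ∈ U, h (p, 0) = x₀) ∧ ∀ p ∈ U, h (p, 1) = p := by
  classical
  obtain ⟨y, ⟨H⟩⟩ := id_nullhomotopic U
  obtain ⟨δ, hδ, hδU⟩ := exists_continuous_pos_ball_subset hU
  let W : TopologicalSpace.Opens (E × ℝ) := ⟨U ×ˢ univ, hU.prod isOpen_univ⟩
  have : ProperSpace E := FiniteDimensional.proper_real E
  have : LocallyCompactSpace W := W.isOpen.locallyCompactSpace
  let K : W → E := fun w =>
    (H (projIcc (0 : ℝ) 1 zero_le_one (2 - 3 * w.1.2), ⟨w.1.1, w.2.1⟩) : U)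
  have hK : Continuous K := by
    refine continuous_subtype_val.comp (H.continuous.comp (Continuous.prodMk ?_ ?_))
    · exact continuous_projIcc.comp (by fun_prop)
    · exact Continuous.subtype_mk (by fun_prop) _
  have hKU : ∀ w, K w ∈ U := fun w => Subtype.property _
  have hK0 : ∀ w : W, w.1.2 < 1 / 3 → K w = y := by
    intro w hw
    have : projIcc (0 : ℝ) 1 zero_le_one (2 - 3 * w.1.2) = 1 :=
      projIcc_of_right_le _ (by linarith)
    simp only [K, this, H.apply_one, ContinuousMap.const_apply]
  have hK1 : ∀ w : W, 2 / 3 < w.1.2 → K w = w.1.1 := by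
    intro w hw
    have : projIcc (0 : ℝ) 1 zero_le_one (2 - 3 * w.1.2) = 0 :=
      projIcc_of_le_left _ (by linarith)
    simp only [K, this, H.apply_zero, ContinuousMap.id_apply]
  let T : W → Set E := fun w =>
    if w.1.2 ≤ 1 / 4 then {(y : E)} else if 3 / 4 ≤ w.1.2 then {w.1.1}
    else Metric.ball (K w) (δ (K w))
  have hT : ∀ w, K w ∈ T w := by
    intro w
    simp only [T]
    split_ifs with h1 h2
    · exact hK0 w (by linarith)
    · exact hK1 w (by linarith)
    · exact Metric.mem_ball_self (hδU _ (hKU w)).1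
  have hTU : ∀ w, T w ⊆ U := by
    intro w
    simp only [T]
    split_ifs with h1 h2
    · simp
    · simpa using w.2.1
    · exact (hδU _ (hKU w)).2
  obtain ⟨g, hg⟩ := exists_contMDiffMap_forall_mem_convex_of_local (n := ⊤) (t := T) 𝓘(ℝ, E × ℝ)
    (F := E) (by
      intro w
      simp only [T]
      split_ifs
      exacts [convex_singleton _, convex_singleton _, convex_ball _ _]) (by
      intro w
      have htime : Continuous fun v : W => v.1.2 := by fun_prop
      rcases lt_or_ge w.1.2 (1 / 3) with h1 | h1
      · refine ⟨{v | v.1.2 < 1 / 3}, (isOpen_lt htime continuous_const).mem_nhds h1,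
          fun _ => y, contMDiffOn_const, fun v hv => ?_⟩
        rw [← hK0 v hv]
        exact hT v
      rcases lt_or_ge (2 / 3) w.1.2 with h2 | h2
      · refine ⟨{v | 2 / 3 < v.1.2}, (isOpen_lt continuous_const htime).mem_nhds h2,
          fun v => v.1.1, ?_, fun v hv => ?_⟩
        · exact (contDiff_fst.contMDiff.comp contMDiff_subtype_val).contMDiffOn
        · change v.1.1 ∈ T v
          rw [← hK1 v hv]
          exact hT v
      · refine ⟨{v | 1 / 4 < v.1.2} ∩ {v | v.1.2 < 3 / 4} ∩ {v | dist (K w) (K v) < δ (K v)},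
          IsOpen.mem_nhds (((isOpen_lt continuous_const htime).inter
            (isOpen_lt htime continuous_const)).inter
            (isOpen_lt (by fun_prop) (by fun_prop))) ⟨⟨?_, ?_⟩, ?_⟩,
          fun _ => K w, contMDiffOn_const, fun v hv => ?_⟩
        · change 1 / 4 < w.1.2
          linarith
        · change w.1.2 < 3 / 4
          linarith
        · simp [(hδU _ (hKU w)).1]
        · obtain ⟨⟨ha, hb⟩, hc⟩ := hv
          simp only [mem_ofPred_eq] at ha hb
          simp only [T, if_neg ha.not_ge, if_neg hb.not_ge]
          exact hc)
  let f : E × ℝ → E := fun z => if hz : z ∈ U ×ˢ (univ : Set ℝ) then g ⟨z, hz⟩ else 0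
  have hf : ∀ w : W, f w.1 = g w := fun w => dif_pos w.2
  refine ⟨f, y, fun z hz => ?_, fun p hp t => ?_, fun p hp => ?_, fun p hp => ?_⟩
  · have h1 : ContMDiffAt 𝓘(ℝ, E × ℝ) 𝓘(ℝ, E) ∞ (fun w : W => f w) (⟨z, hz⟩ : W) := by
      simp only [hf]
      exact g.contMDiff _
    exact (contMDiffAt_iff_contDiffAt.1 (contMDiffAt_subtype_iff.1 h1)).contDiffWithinAt
  · rw [hf ⟨(p, t), hp, trivial⟩]
    exact hTU _ (hg _)
  · have := hg ⟨(p, 0), hp, trivial⟩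
    rw [hf ⟨(p, 0), hp, trivial⟩]
    simpa [T] using this
  · have := hg ⟨(p, 1), hp, trivial⟩
    rw [hf ⟨(p, 1), hp, trivial⟩]
    norm_num [T] at this
    exact this

theorem fderiv_integral_apply {E G : Type*} [NormedAddCommGroup E] [NormedSpace ℝ E]
    [FiniteDimensional ℝ E] [NormedAddCommGroup G] [NormedSpace ℝ G] [CompleteSpace G]
    {U : Set E} (hU : IsOpen U) {F : E × ℝ → G}
    (hF : ContDiffOn ℝ ∞ F (U ×ˢ univ)) {p : E} (hp : p ∈ U) (v : E) :
    fderiv ℝ (fun q => ∫ t in (0 : ℝ)..1, F (q, t)) p v =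
      ∫ t in (0 : ℝ)..1, fderiv ℝ F (p, t) (v, 0) := by
  have hder : Continuous
      fun t : ℝ => (fderiv ℝ F (p, t)).comp (ContinuousLinearMap.inl ℝ E ℝ) :=
    ((hF.continuousOn_fderiv_of_isOpen (hU.prod isOpen_univ) (by simp)).comp_continuous
      (by fun_prop : Continuous fun t : ℝ => (p, t)) fun t => ⟨hp, trivial⟩).clm_comp
      continuous_const
  rw [(hasFDerivAt_integral_of_contDiffOn hU (by simp) hF hp).fderiv,
    ContinuousLinearMap.intervalIntegral_apply (hder.intervalIntegrable _ _)]
  simp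

theorem continuous_fderiv_slice_apply {E G : Type*} [NormedAddCommGroup E] [NormedSpace ℝ E]
    [NormedAddCommGroup G] [NormedSpace ℝ G]
    {U : Set E} (hU : IsOpen U) {F : E × ℝ → G}
    (hF : ContDiffOn ℝ ∞ F (U ×ˢ univ)) {p : E} (hp : p ∈ U) (w : E × ℝ) :
    Continuous fun t : ℝ => fderiv ℝ F (p, t) w :=
  ((hF.continuousOn_fderiv_of_isOpen (hU.prod isOpen_univ) (by simp)).comp_continuous
      (by fun_prop : Continuous fun t : ℝ => (p, t)) fun t => ⟨hp, trivial⟩).clm_apply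
      continuous_const

theorem integral_fderiv_slice {E G : Type*} [NormedAddCommGroup E] [NormedSpace ℝ E]
    [NormedAddCommGroup G] [NormedSpace ℝ G] [CompleteSpace G]
    {U : Set E} (hU : IsOpen U) {F : E × ℝ → G}
    (hF : ContDiffOn ℝ ∞ F (U ×ˢ univ)) {p : E} (hp : p ∈ U) :
    ∫ t in (0 : ℝ)..1, fderiv ℝ F (p, t) (0, 1) = F (p, 1) - F (p, 0) := by
  refine intervalIntegral.integral_eq_sub_of_hasDerivAt (f := fun t => F (p, t)) (fun t _ => ?_)
    ((continuous_fderiv_slice_apply hU hF hp _).intervalIntegrable _ _)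
  have h := ((hF.contDiffAt ((hU.prod isOpen_univ).mem_nhds ⟨hp, trivial⟩)).differentiableAt
    (by simp) : DifferentiableAt ℝ F (p, t)).hasFDerivAt
  exact h.comp_hasDerivAt t ((hasDerivAt_const t p).prodMk (hasDerivAt_id t))

theorem fderiv_slice_eq_id {E : Type*} [NormedAddCommGroup E] [NormedSpace ℝ E]
    {U : Set E} (hU : IsOpen U) {h : E × ℝ → E} (hh : ContDiffOn ℝ ∞ h (U ×ˢ univ)) {s : ℝ}
    (hs : ∀ p ∈ U, h (p, s) = p) {p : E} (hp : p ∈ U) (v : E) :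
    fderiv ℝ h (p, s) (v, 0) = v := by
  have hd := ((hh.contDiffAt ((hU.prod isOpen_univ).mem_nhds ⟨hp, trivial⟩)).differentiableAt
    (by simp) : DifferentiableAt ℝ h (p, s)).hasFDerivAt
  have h1 := HasFDerivAt.comp (f := fun q => (q, s)) p hd (hasFDerivAt_prodMk_left p s)
  have h2 : HasFDerivAt (h ∘ fun q => (q, s)) (ContinuousLinearMap.id ℝ E) p :=
    (hasFDerivAt_id p).congr_of_eventuallyEq
      (Filter.mem_of_superset (hU.mem_nhds hp) fun q hq => hs q hq)
  simpa using DFunLike.congr_fun (h1.unique h2) v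

theorem fderiv_slice_eq_zero {E : Type*} [NormedAddCommGroup E] [NormedSpace ℝ E]
    {U : Set E} (hU : IsOpen U) {h : E × ℝ → E} (hh : ContDiffOn ℝ ∞ h (U ×ˢ univ)) {s : ℝ}
    {x₀ : E} (hs : ∀ p ∈ U, h (p, s) = x₀) {p : E} (hp : p ∈ U) (v : E) :
    fderiv ℝ h (p, s) (v, 0) = 0 := by
  have hd := ((hh.contDiffAt ((hU.prod isOpen_univ).mem_nhds ⟨hp, trivial⟩)).differentiableAt
    (by simp) : DifferentiableAt ℝ h (p, s)).hasFDerivAt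
  have h1 := HasFDerivAt.comp (f := fun q => (q, s)) p hd (hasFDerivAt_prodMk_left p s)
  have h2 : HasFDerivAt (h ∘ fun q => (q, s)) (0 : E →L[ℝ] E) p :=
    (hasFDerivAt_const x₀ p).congr_of_eventuallyEq
      (Filter.mem_of_superset (hU.mem_nhds hp) fun q hq => hs q hq)
  simpa using DFunLike.congr_fun (h1.unique h2) v

/-- Poincaré lemma for closed one-forms on a contractible open set. -/
theorem exists_fderiv_eq_of_closed {E : Type} [NormedAddCommGroup E] [NormedSpace ℝ E]
    [FiniteDimensional ℝ E] {U : Set E} (hU : IsOpen U) (hUc : ContractibleSpace U)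
    {θ : E → E →L[ℝ] ℝ} (hθ : ContDiffOn ℝ ∞ θ U)
    (hclosed : ∀ p ∈ U, ∀ u v, fderiv ℝ θ p u v = fderiv ℝ θ p v u) :
    ∃ φ : E → ℝ, ContDiffOn ℝ ∞ φ U ∧ ∀ p ∈ U, fderiv ℝ φ p = θ p := by
  obtain ⟨h, x₀, hh, hhU, hh0, hh1⟩ := exists_contDiffOn_contraction hU hUc
  have hW : IsOpen (U ×ˢ (univ : Set ℝ)) := hU.prod isOpen_univ
  let S : E × ℝ → E × ℝ → ℝ := fun w z => θ (h z) (fderiv ℝ h z w)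
  have hS : ∀ w, ContDiffOn ℝ ∞ (S w) (U ×ˢ univ) := fun w =>
    (hθ.comp hh fun z hz => hhU z.1 hz.1 z.2).clm_apply
      ((hh.fderiv_of_isOpen hW (by simp)).clm_apply contDiffOn_const)
  have hSder : ∀ w, ∀ z ∈ U ×ˢ (univ : Set ℝ), ∀ v, fderiv ℝ (S w) z v =
      fderiv ℝ θ (h z) (fderiv ℝ h z v) (fderiv ℝ h z w) +
        θ (h z) (fderiv ℝ (fderiv ℝ h) z v w) := by
    intro w z hz v
    have d1 : HasFDerivAt h (fderiv ℝ h z) z :=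
      ((hh.contDiffAt (hW.mem_nhds hz)).differentiableAt (by simp)).hasFDerivAt
    have d2 : HasFDerivAt (fderiv ℝ h) (fderiv ℝ (fderiv ℝ h) z) z :=
      (((hh.fderiv_of_isOpen hW (by simp : ∞ + 1 ≤ ∞)).contDiffAt
        (hW.mem_nhds hz)).differentiableAt (by simp)).hasFDerivAt
    have d3 : HasFDerivAt θ (fderiv ℝ θ (h z)) (h z) :=
      ((hθ.contDiffAt (hU.mem_nhds (hhU z.1 hz.1 z.2))).differentiableAt (by simp)).hasFDerivAt
    have d4 := (d3.comp z d1).clm_apply (d2.clm_apply (hasFDerivAt_const w z))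
    rw [show S w = fun z => (θ ∘ h) z (fderiv ℝ h z w) from rfl, d4.fderiv]
    simp [add_comm]
  refine ⟨fun q => ∫ t in (0 : ℝ)..1, S (0, 1) (q, t), contDiffOn_integral hU (hS _),
    fun p hp => ?_⟩
  ext v
  rw [fderiv_integral_apply hU (hS _) hp]
  have key : ∀ t : ℝ, fderiv ℝ (S (0, 1)) (p, t) (v, 0) = fderiv ℝ (S (v, 0)) (p, t) (0, 1) := by
    intro t
    have hz : (p, t) ∈ U ×ˢ (univ : Set ℝ) := ⟨hp, trivial⟩
    rw [hSder _ _ hz, hSder _ _ hz, hclosed _ (hhU p hp t),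
      (hh.contDiffAt (hW.mem_nhds hz)).isSymmSndFDerivAt
        (by simpa using ENat.LEInfty.out) (v, 0) (0, 1)]
  simp only [key]
  rw [integral_fderiv_slice hU (hS _) hp]
  simp only [S, fderiv_slice_eq_id hU hh hh1 hp, fderiv_slice_eq_zero hU hh hh0 hp, hh1 p hp,
    map_zero, sub_zero]

theorem clm_fin_two_apply (L : (Fin 2 → ℝ) →L[ℝ] ℝ) (v : Fin 2 → ℝ) :
    L v = v 0 * L ![1, 0] + v 1 * L ![0, 1] := by
  have hv : v = v 0 • ![1, 0] + v 1 • ![0, 1] := by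
    ext i
    fin_cases i <;> simp
  conv_lhs => rw [hv]
  simp only [map_add, map_smul, smul_eq_mul]

/-- Poincaré lemma for two-forms on a contractible open subset of the plane. -/
theorem exists_opX_sub_opZ_eq {U : Set (Fin 2 → ℝ)} (hU : IsOpen U) (hUc : ContractibleSpace U)
    {c : (Fin 2 → ℝ) → ℝ} (hc : ContDiffOn ℝ ∞ c U) :
    ∃ a β : (Fin 2 → ℝ) → ℝ, ContDiffOn ℝ ∞ a U ∧ ContDiffOn ℝ ∞ β U ∧
      ∀ p ∈ U, opX β p - opZ a p = c p := by
  obtain ⟨h, x₀, hh, hhU, hh0, hh1⟩ := exists_contDiffOn_contraction hU hUc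
  have hW : IsOpen (U ×ˢ (univ : Set ℝ)) := hU.prod isOpen_univ
  let D : (Fin 2 → ℝ) × ℝ → Fin 2 → (Fin 2 → ℝ) × ℝ → ℝ := fun w i z => fderiv ℝ h z w i
  let S : (Fin 2 → ℝ) × ℝ → (Fin 2 → ℝ) × ℝ → (Fin 2 → ℝ) × ℝ → ℝ := fun u v z =>
    c (h z) * (D u 0 z * D v 1 z - D u 1 z * D v 0 z)
  have hD : ∀ w i, ContDiffOn ℝ ∞ (D w i) (U ×ˢ univ) := fun w =>
    contDiffOn_pi.1 ((hh.fderiv_of_isOpen hW (by simp)).clm_apply contDiffOn_const)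
  have hch : ContDiffOn ℝ ∞ (fun z => c (h z)) (U ×ˢ univ) :=
    hc.comp hh fun z hz => hhU z.1 hz.1 z.2
  have hS : ∀ u v, ContDiffOn ℝ ∞ (S u v) (U ×ˢ univ) := fun u v =>
    hch.mul (((hD u 0).mul (hD v 1)).sub ((hD u 1).mul (hD v 0)))
  have hcyc : ∀ z ∈ U ×ˢ (univ : Set ℝ), ∀ u v w,
      fderiv ℝ (S u v) z w + fderiv ℝ (S v w) z u + fderiv ℝ (S w u) z v = 0 := by
    intro z hz
    have d1 : HasFDerivAt h (fderiv ℝ h z) z :=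
      ((hh.contDiffAt (hW.mem_nhds hz)).differentiableAt (by simp)).hasFDerivAt
    have d2 : HasFDerivAt (fderiv ℝ h) (fderiv ℝ (fderiv ℝ h) z) z :=
      (((hh.fderiv_of_isOpen hW (by simp : ∞ + 1 ≤ ∞)).contDiffAt
        (hW.mem_nhds hz)).differentiableAt (by simp)).hasFDerivAt
    have d3 : HasFDerivAt c (fderiv ℝ c (h z)) (h z) :=
      ((hc.contDiffAt (hU.mem_nhds (hhU z.1 hz.1 z.2))).differentiableAt (by simp)).hasFDerivAt
    have hsymm := (hh.contDiffAt (hW.mem_nhds hz)).isSymmSndFDerivAt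
      (by simpa using ENat.LEInfty.out)
    have hDd : ∀ w i, HasFDerivAt (D w i)
        ((ContinuousLinearMap.proj i).comp ((fderiv ℝ (fderiv ℝ h) z).flip w)) z := by
      intro w i
      have := hasFDerivAt_pi'.1 (d2.clm_apply (hasFDerivAt_const w z)) i
      simpa using this
    have hSd : ∀ u v w, fderiv ℝ (S u v) z w =
        (D w 0 z * fderiv ℝ c (h z) ![1, 0] + D w 1 z * fderiv ℝ c (h z) ![0, 1]) *
          (D u 0 z * D v 1 z - D u 1 z * D v 0 z) +
        c (h z) * (fderiv ℝ (fderiv ℝ h) z w u 0 * D v 1 z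
          + D u 0 z * fderiv ℝ (fderiv ℝ h) z w v 1
          - fderiv ℝ (fderiv ℝ h) z w u 1 * D v 0 z
          - D u 1 z * fderiv ℝ (fderiv ℝ h) z w v 0) := by
      intro u v w
      have d4 := (d3.comp z d1).mul
        (((hDd u 0).mul (hDd v 1)).sub ((hDd u 1).mul (hDd v 0)))
      rw [← clm_fin_two_apply (fderiv ℝ c (h z)) (fderiv ℝ h z w)]
      refine (DFunLike.congr_fun (HasFDerivAt.fderiv (f := S u v) d4) w).trans ?_
      simp
      ring
    intro u v w
    rw [hSd, hSd, hSd, hsymm w u, hsymm w v, hsymm u v]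
    ring
  refine ⟨fun q => ∫ t in (0 : ℝ)..1, S (0, 1) (![1, 0], 0) (q, t),
    fun q => -∫ t in (0 : ℝ)..1, S (![0, 1], 0) (0, 1) (q, t),
    contDiffOn_integral hU (hS _ _), (contDiffOn_integral hU (hS _ _)).neg, fun p hp => ?_⟩
  have key : ∀ t : ℝ, fderiv ℝ (S (![1, 0], 0) (![0, 1], 0)) (p, t) (0, 1) =
      -fderiv ℝ (S (![0, 1], 0) (0, 1)) (p, t) (![1, 0], 0)
        - fderiv ℝ (S (0, 1) (![1, 0], 0)) (p, t) (![0, 1], 0) := fun t => by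
    linear_combination hcyc (p, t) ⟨hp, trivial⟩ (![1, 0], 0) (![0, 1], 0) (0, 1)
  have hA := integral_fderiv_slice hU (hS (![1, 0], 0) (![0, 1], 0)) hp
  simp only [key] at hA
  rw [intervalIntegral.integral_sub
    ((continuous_fderiv_slice_apply hU (hS _ _) hp _).fun_neg.intervalIntegrable _ _)
    ((continuous_fderiv_slice_apply hU (hS _ _) hp _).intervalIntegrable _ _),
    intervalIntegral.integral_neg, ← fderiv_integral_apply hU (hS _ _) hp,
    ← fderiv_integral_apply hU (hS _ _) hp] at hA
  simp only [opX, opZ, fderiv_fun_neg, neg_apply]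
  rw [hA]
  simp [S, D, fderiv_slice_eq_id hU hh hh1 hp, fderiv_slice_eq_zero hU hh hh0 hp, hh1 p hp]

theorem opY_eq_mul_opZ (f : (Fin 2 → ℝ) → ℝ) (p : Fin 2 → ℝ) : opY f p = p 0 * opZ f p := by
  rw [opY, opZ, clm_fin_two_apply]
  simp

/-- A potential for the closed one-form `x c dx - d dy`. -/
theorem exists_potential {U : Set (Fin 2 → ℝ)} (hU : IsOpen U) (hUc : ContractibleSpace U)
    {c d : (Fin 2 → ℝ) → ℝ} (hc : ContDiffOn ℝ ∞ c U) (hd : ContDiffOn ℝ ∞ d U)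
    (hcd : ∀ p ∈ U, opX d p + opY c p = 0) :
    ∃ φ : (Fin 2 → ℝ) → ℝ, ContDiffOn ℝ ∞ φ U ∧
      ∀ p ∈ U, opX φ p = p 0 * c p ∧ opZ φ p = -d p := by
  let P : Fin 2 → (Fin 2 → ℝ) →L[ℝ] ℝ := fun i => ContinuousLinearMap.proj i
  let θ : (Fin 2 → ℝ) → (Fin 2 → ℝ) →L[ℝ] ℝ := fun p => (p 0 * c p) • P 0 - d p • P 1
  have hθ : ContDiffOn ℝ ∞ θ U :=
    (((contDiff_apply ℝ ℝ 0).contDiffOn.mul hc).smul contDiffOn_const).sub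
      (hd.smul contDiffOn_const)
  obtain ⟨φ, hφ, hφθ⟩ := exists_fderiv_eq_of_closed hU hUc hθ (by
    intro p hp u v
    have hc' := ((hc.contDiffAt (hU.mem_nhds hp)).differentiableAt (by simp)).hasFDerivAt
    have hd' := ((hd.contDiffAt (hU.mem_nhds hp)).differentiableAt (by simp)).hasFDerivAt
    have hθ' : HasFDerivAt θ _ p :=
      (((P 0).hasFDerivAt.mul hc').smul_const (P 0)).sub (hd'.smul_const (P 1))
    have h := hcd p hp
    rw [opY_eq_mul_opZ] at h
    simp only [opX, opZ] at h
    rw [hθ'.fderiv]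
    simp [P]
    rw [clm_fin_two_apply _ u, clm_fin_two_apply _ v, clm_fin_two_apply (fderiv ℝ d p) u,
      clm_fin_two_apply (fderiv ℝ d p) v]
    linear_combination (u 1 * v 0 - u 0 * v 1) * h)
  refine ⟨φ, hφ, fun p hp => ⟨?_, ?_⟩⟩
  · simp [opX, hφθ p hp, θ, P]
  · simp [opZ, hφθ p hp, θ, P]

theorem first_grushin_exact_degree_two
    (U : Set (Fin 2 → ℝ)) (hU : IsOpen U) (hUc : ContractibleSpace U)
    (c d : (Fin 2 → ℝ) → ℝ)
    (hc : ContDiffOn ℝ (⊤ : ℕ∞) c U) (hd : ContDiffOn ℝ (⊤ : ℕ∞) d U)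
    (hcd : ∀ p ∈ U, opX d p + opY c p = 0) :
    ∃ a b : (Fin 2 → ℝ) → ℝ, ContDiffOn ℝ (⊤ : ℕ∞) a U ∧ ContDiffOn ℝ (⊤ : ℕ∞) b U ∧
      ∀ p ∈ U,
        c p = opX (opX b) p - (opX (opY a) p + opZ a p) ∧
        d p = opY (opY a) p - (opY (opX b) p - opZ b p) := by
  obtain ⟨φ, hφ, hφp⟩ := exists_potential hU hUc hc hd hcd
  obtain ⟨a, β, ha, hβ, haβ⟩ := exists_opX_sub_opZ_eq hU hUc hc
  have hx : ContDiffOn ℝ ∞ (fun p : Fin 2 → ℝ => p 0) U := (contDiff_apply ℝ ℝ 0).contDiffOn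
  have diff : ∀ {f : (Fin 2 → ℝ) → ℝ}, ContDiffOn ℝ ∞ f U → ∀ p ∈ U, DifferentiableAt ℝ f p :=
    fun hf p hp => (hf.contDiffAt (hU.mem_nhds hp)).differentiableAt (by simp)
  have hYa : ContDiffOn ℝ ∞ (opY a) U := by
    rw [funext (opY_eq_mul_opZ a)]
    exact hx.mul ((ha.fderiv_of_isOpen hU (by simp)).clm_apply contDiffOn_const)
  let b : (Fin 2 → ℝ) → ℝ := fun p => p 0 * β p - φ p
  have hb : ContDiffOn ℝ ∞ b U := (hx.mul hβ).sub hφ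
  have hbd : ∀ p ∈ U, ∀ v, fderiv ℝ b p v =
      p 0 * fderiv ℝ β p v + v 0 * β p - fderiv ℝ φ p v := by
    intro p hp v
    have h0 : HasFDerivAt (fun q : Fin 2 → ℝ => q 0) _ p :=
      (ContinuousLinearMap.proj (R := ℝ) (φ := fun _ : Fin 2 => ℝ) 0).hasFDerivAt
    have h1 : HasFDerivAt b _ p :=
      (h0.mul (diff hβ p hp).hasFDerivAt).sub (diff hφ p hp).hasFDerivAt
    rw [h1.fderiv]
    simp [mul_comm]
  have hXb : ∀ p ∈ U, opX b p = β p + opY a p := by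
    intro p hp
    have h1 := (hφp p hp).1
    have h2 := haβ p hp
    rw [opY_eq_mul_opZ]
    simp only [opX] at h1 h2 ⊢
    rw [hbd p hp, h1]
    simp only [Matrix.cons_val_zero]
    linear_combination p 0 * h2
  have hXb' : ∀ p ∈ U, fderiv ℝ (opX b) p = fderiv ℝ β p + fderiv ℝ (opY a) p := by
    intro p hp
    rw [← fderiv_add (diff hβ p hp) (diff hYa p hp)]
    exact Filter.EventuallyEq.fderiv_eq
      (Filter.mem_of_superset (hU.mem_nhds hp) fun q hq => hXb q hq)
  refine ⟨a, b, ha, hb, fun p hp => ⟨?_, ?_⟩⟩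
  · have h1 := haβ p hp
    simp only [opX, opZ] at h1
    change c p = fderiv ℝ (opX b) p ![1, 0] - (fderiv ℝ (opY a) p ![1, 0] + fderiv ℝ a p ![0, 1])
    rw [hXb' p hp, add_apply]
    linear_combination -h1
  · have h1 := (hφp p hp).2
    have h2 := opY_eq_mul_opZ β p
    simp only [opY, opZ] at h1 h2
    change d p = fderiv ℝ (opY a) p ![0, p 0] -
      (fderiv ℝ (opX b) p ![0, p 0] - fderiv ℝ b p ![0, 1])
    rw [hXb' p hp, add_apply, hbd p hp, h1]
    simp only [Matrix.cons_val_zero]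
    linear_combination h2
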